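/- For every fixed m ≥ 0, the map Ω ↦ (u(Ω), v(Ω)) is a bijection between the sequences in RTSeq of length m and the pairs (u, v) ∈ S_∞ × S_∞ such that ℓ_a(v) − ℓ_a(u) ∈ {0, 1} for 1 ≤ a ≤ m and ℓ_a(u) = ℓ_a(v) = 1 for all a ≥ m + 1. -/

import Mathlib

/-!
Statement 12.  For fixed `m ≥ 0`, the map `Ω ↦ (u(Ω), v(Ω))` is a bijection between
the sequences in `RTSeq` of length `m` and the pairs `(u, v) ∈ S_∞ × S_∞` such that
`ℓ_a(v) − ℓ_a(u) ∈ {0, 1}` for `1 ≤ a ≤ m` and `ℓ_a(u) = ℓ_a(v) = 1` for `a ≥ m + 1`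
(0-indexed: `a < m`, resp. `a ≥ m`).
-/

/-- Permutations of the positive integers are modelled by `Equiv.Perm ℕ`, the positive
integer `p` corresponding to `p − 1 : ℕ`.  The insertion map `ins_i` (here `ins (i-1)`,
`0`-indexed) sends `j ↦ w(j) + 1` for `j < i`, `i ↦ 0`, and `j ↦ w(j−1) + 1` for `j > i`. -/
def ins (i : ℕ) (w : Equiv.Perm ℕ) : Equiv.Perm ℕ where
  toFun j := if j < i then w j + 1 else if j = i then 0 else w (j - 1) + 1
  invFun b := if b = 0 then i else if w.symm (b - 1) < i then w.symm (b - 1) else w.symm (b - 1) + 1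
  left_inv := by
    intro j
    dsimp only
    by_cases h1 : j < i
    · rw [if_pos h1, if_neg (by omega : ¬ (w j + 1 = 0)), Nat.add_sub_cancel,
        Equiv.symm_apply_apply, if_pos h1]
    · by_cases h2 : j = i
      · rw [if_neg h1, if_pos h2, if_pos rfl, h2]
      · rw [if_neg h1, if_neg h2, if_neg (by omega : ¬ (w (j - 1) + 1 = 0)),
          Nat.add_sub_cancel, Equiv.symm_apply_apply,
          if_neg (by omega : ¬ (j - 1 < i)), Nat.sub_add_cancel (by omega)]
  right_inv := by
    intro b
    dsimp only
    by_cases hb : b = 0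
    · rw [if_pos hb, if_neg (lt_irrefl i), if_pos rfl, hb]
    · rw [if_neg hb]
      by_cases hc : w.symm (b - 1) < i
      · rw [if_pos hc, if_pos hc, Equiv.apply_symm_apply, Nat.sub_add_cancel (by omega)]
      · rw [if_neg hc, if_neg (by omega : ¬ (w.symm (b - 1) + 1 < i)),
          if_neg (by omega : ¬ (w.symm (b - 1) + 1 = i)), Nat.add_sub_cancel,
          Equiv.apply_symm_apply, Nat.sub_add_cancel (by omega)]

/-- The number `ℓ(u)` of inversions of `u`. -/
noncomputable def invCount (u : Equiv.Perm ℕ) : ℕ :=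
  Set.ncard {p : ℕ × ℕ | p.1 < p.2 ∧ u p.2 < u p.1}

/-- The Bruhat order: `u ≤ v` iff there is a chain `u = w₀, …, w_m = v` where each
`w_{s+1} = w_s · τ_s` for a transposition `τ_s`, with `ℓ(w_{s+1}) > ℓ(w_s)`. -/
noncomputable def bruhatLE (u v : Equiv.Perm ℕ) : Prop :=
  ∃ (m : ℕ) (c : ℕ → Equiv.Perm ℕ), c 0 = u ∧ c m = v ∧
    ∀ s < m, (∃ a b : ℕ, a ≠ b ∧ c (s + 1) = c s * Equiv.swap a b) ∧
      invCount (c s) < invCount (c (s + 1))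

/-- `ℓ_a(u) = #{b ≥ a : u⁻¹(b) ≤ u⁻¹(a)}` (0-indexed: this is `ℓ_{a+1}` of the paper). -/
noncomputable def lA (a : ℕ) (u : Equiv.Perm ℕ) : ℕ :=
  Set.ncard {b : ℕ | a ≤ b ∧ u.symm b ≤ u.symm a}

/-- `u` fixes all but finitely many points, i.e. `u ∈ S_∞`. -/
def finitary (u : Equiv.Perm ℕ) : Prop := {a : ℕ | u a ≠ a}.Finite

/-- `u ∈ S_n`: `u` fixes every point `j > n` (0-indexed: every `j ≥ n`). -/
def inSn (n : ℕ) (u : Equiv.Perm ℕ) : Prop := ∀ j, n ≤ j → u j = j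

/-- The formal letters `r_j, t_j` (`j ≥ 1`); here `RTLetter.r k` stands for `r_{k+1}`
and `RTLetter.t k` for `t_{k+1}`. -/
inductive RTLetter : Type
  | r : ℕ → RTLetter
  | t : ℕ → RTLetter
deriving DecidableEq

/-- One step of the recursion defining `(u(Ω), v(Ω))`:
`r_j` maps `(u,v) ↦ (ins_j u, ins_j v)` and `t_j` maps `(u,v) ↦ (ins_j u, ins_{j+1} v)`. -/
def stepRT (p : Equiv.Perm ℕ × Equiv.Perm ℕ) : RTLetter → Equiv.Perm ℕ × Equiv.Perm ℕ
  | .r k => (ins k p.1, ins k p.2)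
  | .t k => (ins k p.1, ins (k + 1) p.2)

/-- The pair `(u(Ω), v(Ω))` attached to a sequence `Ω` (a list of letters, first letter
first):  `u(∅) = v(∅) = id`, and the last letter is applied outermost. -/
def uv (L : List RTLetter) : Equiv.Perm ℕ × Equiv.Perm ℕ := L.foldl stepRT (1, 1)

/-- The letter at (0-indexed) position `p` of a sequence in `RTSeq_n` must lie in
`{r₁, t₁, …, r_{p}, t_{p}, r_{p+1}}` (1-indexed position `s = p+1`). -/
def validLetter (p : ℕ) : RTLetter → Prop
  | .r k => k ≤ p
  | .t k => k + 1 ≤ p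

/-- `Ω ∈ RTSeq_n`: a sequence of `n` letters `X₁⋯X_n` with
`X_s ∈ {r₁, t₁, …, r_{s−1}, t_{s−1}, r_s}`. -/
def validSeq (n : ℕ) (L : List RTLetter) : Prop :=
  L.length = n ∧ ∀ p < L.length, validLetter p (L.getD p (.r 0))

/-- `|Ω|_t`, the number of letters of the form `t_j`. -/
def countT (L : List RTLetter) : ℕ :=
  L.countP (fun X => match X with | .t _ => true | .r _ => false)

/-- `c_n`, the backwards long cycle `n 1 2 ⋯ (n−1)` (0-indexed on `ℕ`:
`0 ↦ n−1`, `j ↦ j−1` for `1 ≤ j ≤ n−1`, `j ↦ j` for `j ≥ n`). -/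
def cB (n : ℕ) : Equiv.Perm ℕ where
  toFun j := if j = 0 then n - 1 else if j ≤ n - 1 then j - 1 else j
  invFun j := if j = n - 1 then 0 else if j < n - 1 then j + 1 else j
  left_inv := by
    intro j
    dsimp only
    split_ifs <;> (try exact absurd rfl ‹_›) <;> (try exact (‹False›).elim) <;> omega
  right_inv := by
    intro j
    dsimp only
    split_ifs <;> (try exact absurd rfl ‹_›) <;> (try exact (‹False›).elim) <;> omega

/-- `Ω′` is obtained from `Ω` by replacing the letters `t_i` at some subset of the
positions by either `r_i` or `r_{i+1}`. -/
def isReplacement (L L' : List RTLetter) : Prop :=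
  L'.length = L.length ∧
  ∀ p < L.length,
    L'.getD p (.r 0) = L.getD p (.r 0) ∨
    ∃ k, L.getD p (.r 0) = .t k ∧ (L'.getD p (.r 0) = .r k ∨ L'.getD p (.r 0) = .r (k + 1))


theorem ins_symm_zero (i : ℕ) (w : Equiv.Perm ℕ) : (ins i w).symm 0 = i := rfl

theorem ins_symm_succ (i : ℕ) (w : Equiv.Perm ℕ) (b : ℕ) :
    (ins i w).symm (b + 1) = if w.symm b < i then w.symm b else w.symm b + 1 := rfl

theorem ins_apply (i : ℕ) (w : Equiv.Perm ℕ) (j : ℕ) :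
    ins i w j = if j < i then w j + 1 else if j = i then 0 else w (j - 1) + 1 := rfl

theorem ins_inj {i j : ℕ} {w x : Equiv.Perm ℕ} (h : ins i w = ins j x) : i = j ∧ w = x := by
  have hij : i = j := by rw [← ins_symm_zero i w, h, ins_symm_zero]
  subst hij
  refine ⟨rfl, Equiv.symm_bijective.injective (Equiv.ext fun b => ?_)⟩
  have hb : (ins i w).symm (b + 1) = (ins i x).symm (b + 1) := by rw [h]
  rw [ins_symm_succ, ins_symm_succ] at hb
  split_ifs at hb <;> omega

theorem exists_eq_ins (u : Equiv.Perm ℕ) : ∃ w, u = ins (u.symm 0) w := by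
  have hne (j : ℕ) (hj : j ≠ u.symm 0) : u j ≠ 0 := fun h => hj (by rw [← h, u.symm_apply_apply])
  have hne' (b : ℕ) : u.symm (b + 1) ≠ u.symm 0 := fun h => by simpa using u.symm.injective h
  refine ⟨⟨fun j => u (if j < u.symm 0 then j else j + 1) - 1,
    fun b => if u.symm (b + 1) < u.symm 0 then u.symm (b + 1) else u.symm (b + 1) - 1,
    fun j => ?_, fun b => ?_⟩, Equiv.ext fun j => ?_⟩
  · have h : (if j < u.symm 0 then j else j + 1) ≠ u.symm 0 := by split_ifs <;> omega
    have h' := hne _ h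
    simp only [Nat.sub_add_cancel (Nat.pos_of_ne_zero h'), Equiv.symm_apply_apply]
    split_ifs <;> omega
  · have h := hne' b
    have h' : (if (if u.symm (b + 1) < u.symm 0 then u.symm (b + 1) else u.symm (b + 1) - 1)
        < u.symm 0 then (if u.symm (b + 1) < u.symm 0 then u.symm (b + 1) else u.symm (b + 1) - 1)
        else (if u.symm (b + 1) < u.symm 0 then u.symm (b + 1) else u.symm (b + 1) - 1) + 1)
        = u.symm (b + 1) := by split_ifs <;> omega
    simp only [h', Equiv.apply_symm_apply, Nat.add_sub_cancel]
  · rw [ins_apply]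
    simp only [Equiv.coe_fn_mk]
    split_ifs with h1 h2 h3
    · have := hne j (by omega); omega
    · rw [h2, u.apply_symm_apply]
    · omega
    · have := hne j h2
      rw [Nat.sub_add_cancel (by omega : 1 ≤ j)]
      omega

theorem finitary_ins (i : ℕ) {w : Equiv.Perm ℕ} (hw : finitary w) : finitary (ins i w) := by
  obtain ⟨N, hN⟩ := hw.bddAbove
  refine (Set.finite_Iic (N + i + 1)).subset fun j hj => ?_
  by_contra hlt
  simp only [Set.mem_Iic, not_le] at hlt
  have hfix : w (j - 1) = j - 1 := by
    by_contra h
    have : j - 1 ≤ N := hN h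
    omega
  apply hj
  rw [ins_apply, if_neg (by omega), if_neg (by omega), hfix]
  omega

theorem lA_zero (u : Equiv.Perm ℕ) : lA 0 u = u.symm 0 + 1 := by
  have h : {b : ℕ | 0 ≤ b ∧ u.symm b ≤ u.symm 0} = u.symm ⁻¹' (Set.Iic (u.symm 0)) := by
    ext b; simp
  rw [lA, h, ← Equiv.image_eq_preimage_symm, Set.ncard_image_of_injective _ u.injective,
    Set.ncard_eq_toFinset_card']
  simp

theorem lA_succ_ins (a i : ℕ) (w : Equiv.Perm ℕ) : lA (a + 1) (ins i w) = lA a w := by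
  have h : {b : ℕ | a + 1 ≤ b ∧ (ins i w).symm b ≤ (ins i w).symm (a + 1)} =
      Nat.succ '' {b : ℕ | a ≤ b ∧ w.symm b ≤ w.symm a} := by
    ext b
    rcases b with _ | b
    · simp
    · simp only [Set.mem_ofPred_eq, ins_symm_succ, Set.mem_image, Nat.succ_eq_add_one,
        Nat.add_right_cancel_iff, exists_eq_right]
      split_ifs <;> omega
  rw [lA, h, Set.ncard_image_of_injective _ Nat.succ_injective, lA]

theorem lA_one (a : ℕ) : lA a 1 = 1 := by
  rw [lA, Set.ncard_eq_one]
  refine ⟨a, Set.ext fun b => ?_⟩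
  change a ≤ b ∧ b ≤ a ↔ b = a
  omega

theorem eq_one_of_lA_eq_one {u : Equiv.Perm ℕ} (h : ∀ a, lA a u = 1) : u = 1 := by
  have hmono : StrictMono u.symm := by
    intro a b hab
    by_contra hle
    obtain ⟨c, hc⟩ := Set.ncard_eq_one.mp (h a)
    have ha : a ∈ ({c} : Set ℕ) := hc ▸ ⟨le_rfl, le_rfl⟩
    have hb : b ∈ ({c} : Set ℕ) := hc ▸ ⟨hab.le, not_lt.mp hle⟩
    simp only [Set.mem_singleton_iff] at ha hb
    omega
  ext a
  have hiso := congrArg (fun e : ℕ ≃o ℕ => e (u a)) (Subsingleton.elim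
    (hmono.orderIsoOfSurjective _ u.symm.surjective) (OrderIso.refl ℕ))
  simpa using hiso.symm

/-- The condition on the numbers `ℓ_a` characterizing the pairs coming from sequences of
length `m`. -/
def CodePair (m : ℕ) (p : Equiv.Perm ℕ × Equiv.Perm ℕ) : Prop :=
  (∀ a < m, lA a p.2 = lA a p.1 ∨ lA a p.2 = lA a p.1 + 1) ∧
    ∀ a, m ≤ a → lA a p.1 = 1 ∧ lA a p.2 = 1

theorem codePair_zero {p : Equiv.Perm ℕ × Equiv.Perm ℕ} : CodePair 0 p ↔ p = (1, 1) := by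
  refine ⟨fun h => Prod.ext ?_ ?_, ?_⟩
  · exact eq_one_of_lA_eq_one fun a => (h.2 a a.zero_le).1
  · exact eq_one_of_lA_eq_one fun a => (h.2 a a.zero_le).2
  · rintro rfl
    exact ⟨fun a ha => absurd ha a.not_lt_zero, fun a _ => ⟨lA_one a, lA_one a⟩⟩

theorem codePair_stepRT {m : ℕ} {p : Equiv.Perm ℕ × Equiv.Perm ℕ} {X : RTLetter} :
    CodePair (m + 1) (stepRT p X) ↔ CodePair m p := by
  have h0 : lA 0 (stepRT p X).2 = lA 0 (stepRT p X).1 ∨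
      lA 0 (stepRT p X).2 = lA 0 (stepRT p X).1 + 1 := by
    cases X <;> simp [stepRT, lA_zero, ins_symm_zero]
  have h1 (a : ℕ) : lA (a + 1) (stepRT p X).1 = lA a p.1 := by
    cases X <;> exact lA_succ_ins ..
  have h2 (a : ℕ) : lA (a + 1) (stepRT p X).2 = lA a p.2 := by
    cases X <;> exact lA_succ_ins ..
  constructor
  · rintro ⟨hlt, hge⟩
    refine ⟨fun a ha => ?_, fun a ha => ?_⟩
    · simpa only [h1, h2] using hlt (a + 1) (by omega)
    · simpa only [h1, h2] using hge (a + 1) (by omega)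
  · rintro ⟨hlt, hge⟩
    refine ⟨fun a ha => ?_, fun a ha => ?_⟩
    · rcases a with _ | a
      · exact h0
      · simpa only [h1, h2] using hlt a (by omega)
    · rcases a with _ | a
      · omega
      · simpa only [h1, h2] using hge a (by omega)

theorem CodePair.exists_eq_stepRT {m : ℕ} {p : Equiv.Perm ℕ × Equiv.Perm ℕ}
    (h : CodePair (m + 1) p) : ∃ q X, p = stepRT q X := by
  obtain ⟨u, v⟩ := p
  obtain ⟨u', hu⟩ := exists_eq_ins u
  obtain ⟨v', hv⟩ := exists_eq_ins v
  have h0 := h.1 0 m.succ_pos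
  simp only [lA_zero] at h0
  rcases h0 with h0 | h0
  · refine ⟨(u', v'), .r (u.symm 0), Prod.ext hu ?_⟩
    rwa [show v.symm 0 = u.symm 0 by omega] at hv
  · refine ⟨(u', v'), .t (u.symm 0), Prod.ext hu ?_⟩
    rwa [show v.symm 0 = u.symm 0 + 1 by omega] at hv

theorem stepRT_inj {p q : Equiv.Perm ℕ × Equiv.Perm ℕ} {X Y : RTLetter}
    (h : stepRT p X = stepRT q Y) : p = q ∧ X = Y := by
  obtain ⟨p₁, p₂⟩ := p
  obtain ⟨q₁, q₂⟩ := q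
  cases X <;> cases Y <;> simp only [stepRT, Prod.mk.injEq] at h <;>
    obtain ⟨hi, hu⟩ := ins_inj h.1 <;> obtain ⟨hj, hv⟩ := ins_inj h.2 <;>
    first | omega | exact ⟨by rw [hu, hv], by rw [hi]⟩

theorem uv_concat (L : List RTLetter) (X : RTLetter) : uv (L ++ [X]) = stepRT (uv L) X := by
  simp [uv]

theorem finitary_uv (L : List RTLetter) : finitary (uv L).1 ∧ finitary (uv L).2 := by
  induction L using List.reverseRecOn with
  | nil => constructor <;> simp [uv, finitary]
  | append_singleton L X ih =>
    rw [uv_concat]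
    cases X <;> exact ⟨finitary_ins _ ih.1, finitary_ins _ ih.2⟩

theorem codePair_uv (L : List RTLetter) : CodePair L.length (uv L) := by
  induction L using List.reverseRecOn with
  | nil => exact codePair_zero.mpr rfl
  | append_singleton L X ih =>
    rw [uv_concat, List.length_append, List.length_singleton]
    exact codePair_stepRT.mpr ih

theorem uv_inj_of_length_eq {L M : List RTLetter} (hlen : L.length = M.length)
    (h : uv L = uv M) : L = M := by
  induction L using List.reverseRecOn generalizing M with
  | nil => exact (List.length_eq_zero_iff.mp hlen.symm).symm
  | append_singleton L X ih =>
    rcases List.eq_nil_or_concat M with rfl | ⟨M, Y, rfl⟩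
    · simp at hlen
    · rw [List.concat_eq_append] at h hlen ⊢
      rw [uv_concat, uv_concat] at h
      obtain ⟨hp, rfl⟩ := stepRT_inj h
      rw [ih (by simpa using hlen) hp]

theorem CodePair.exists_uv_eq {m : ℕ} {p : Equiv.Perm ℕ × Equiv.Perm ℕ} (h : CodePair m p) :
    ∃ L : List RTLetter, L.length = m ∧ uv L = p := by
  induction m generalizing p with
  | zero => exact ⟨[], rfl, (codePair_zero.mp h).symm⟩
  | succ m ih =>
    obtain ⟨q, X, rfl⟩ := h.exists_eq_stepRT
    obtain ⟨L, rfl, rfl⟩ := ih (codePair_stepRT.mp h)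
    exact ⟨L ++ [X], by simp, uv_concat L X⟩

theorem stmt12 (m : ℕ) :
    Set.BijOn uv {L : List RTLetter | L.length = m}
      {p : Equiv.Perm ℕ × Equiv.Perm ℕ |
        finitary p.1 ∧ finitary p.2 ∧
        (∀ a < m, lA a p.2 = lA a p.1 ∨ lA a p.2 = lA a p.1 + 1) ∧
        (∀ a, m ≤ a → lA a p.1 = 1 ∧ lA a p.2 = 1)} := by
  refine ⟨?_, fun L hL M hM h => uv_inj_of_length_eq (hL.trans hM.symm) h, ?_⟩
  · rintro L rfl
    exact ⟨(finitary_uv L).1, (finitary_uv L).2, codePair_uv L⟩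
  · rintro p ⟨-, -, h⟩
    exact CodePair.exists_uv_eq h
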